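/- Let d ≥ 1, α ∈ (-1,1), σ_X, σ_Y > 0, C ⊆ ℝ^d nonempty, θ̂ : ℝ^d → ℝ^d measurable, and k* > 1. Suppose that for every z ∈ (1, k*], R_α(θ, q_{θ̂,z}) ≤ R_α(θ, q_{θ̂,1}) for all θ ∈ C, and that there exists θ₀ ∈ C with R_α(θ₀, q_{θ̂,z}) < R_α(θ₀, q_{θ̂,1}) for all z ∈ (1, k*]. Let μ be a probability measure on ℝ with μ((1, k*]) = 1, and define the mixture predictive density q̂_F(y; x) = ∫ q_{θ̂,z}(y; x) dμ(z). Then R_α(θ, q̂_F) ≤ R_α(θ, q_{θ̂,1}) for all θ ∈ C and R_α(θ₀, q̂_F) < R_α(θ₀, q_{θ̂,1}); i.e., q̂_F dominates q_{θ̂,1} over C. -/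

import Mathlib

open MeasureTheory Real

/-- Density of the `N_d(μ, v I_d)` distribution on `ℝ^d` (with `v` the variance). -/
noncomputable def gaussPdf (d : ℕ) (μ : EuclideanSpace ℝ (Fin d)) (v : ℝ)
    (y : EuclideanSpace ℝ (Fin d)) : ℝ :=
  (2 * π * v) ^ (-(d : ℝ) / 2) * Real.exp (-‖y - μ‖ ^ 2 / (2 * v))

/-- The α-divergence loss of a predictive density `p` for a target density `q` on `ℝ^d`. -/
noncomputable def alphaLoss (d : ℕ) (α : ℝ) (q p : EuclideanSpace ℝ (Fin d) → ℝ) : ℝ :=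
  ∫ y, (4 / (1 - α ^ 2)) * (1 - (p y / q y) ^ ((1 + α) / 2)) * q y

/-- Frequentist α-divergence risk of a general predictive density `p x : ℝ^d → ℝ`
(depending on the data `x`) for the target `N_d(θ, σ_Y² I_d)`, with `X ~ N_d(θ, σ_X² I_d)`. -/
noncomputable def alphaRiskGen (d : ℕ) (α σX σY : ℝ)
    (p : EuclideanSpace ℝ (Fin d) → EuclideanSpace ℝ (Fin d) → ℝ)
    (θ : EuclideanSpace ℝ (Fin d)) : ℝ :=
  ∫ x, gaussPdf d θ (σX ^ 2) x * alphaLoss d α (gaussPdf d θ (σY ^ 2)) (p x)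

/-- Frequentist α-divergence risk of the predictive density `N_d(θhat X, c²σ_Y² I_d)`. -/
noncomputable def alphaRisk (d : ℕ) (α σX σY : ℝ)
    (θhat : EuclideanSpace ℝ (Fin d) → EuclideanSpace ℝ (Fin d)) (c : ℝ)
    (θ : EuclideanSpace ℝ (Fin d)) : ℝ :=
  alphaRiskGen d α σX σY (fun x => gaussPdf d (θhat x) (c ^ 2 * σY ^ 2)) θ

lemma gaussPdf_pos (d : ℕ) (m : EuclideanSpace ℝ (Fin d)) (v : ℝ) (hv : 0 < v)
    (y : EuclideanSpace ℝ (Fin d)) : 0 < gaussPdf d m v y := by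
  unfold gaussPdf
  positivity

lemma integrable_exp_norm (d : ℕ) (a : ℝ) (ha : 0 < a) :
    Integrable (fun y : EuclideanSpace ℝ (Fin d) => Real.exp (-‖y‖ ^ 2 / a)) := by
  have h := GaussianFourier.integrable_cexp_neg_mul_sq_norm_add
    (V := EuclideanSpace ℝ (Fin d)) (b := ((1 / a : ℝ) : ℂ)) (by simpa using ha) 0 0
  have h2 := h.norm
  refine h2.congr (Filter.Eventually.of_forall fun y => ?_)
  simp only [Complex.norm_exp]
  congr 1
  simp only [zero_mul, add_zero]
  rw [← Complex.ofReal_neg, ← Complex.ofReal_pow, ← Complex.ofReal_mul, Complex.ofReal_re]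
  ring

lemma integrable_gaussPdf (d : ℕ) (m : EuclideanSpace ℝ (Fin d)) (v : ℝ) (hv : 0 < v) :
    Integrable (gaussPdf d m v) := by
  unfold gaussPdf
  exact ((integrable_exp_norm d (2 * v) (by positivity)).comp_sub_right m).const_mul _

/-- uniform bound for the predictive densities. -/
noncomputable def bd (d : ℕ) (s k : ℝ) (y : EuclideanSpace ℝ (Fin d)) : ℝ :=
  (2 * π * s ^ 2) ^ (-(d : ℝ) / 2) * Real.exp (-‖y‖ ^ 2 / (2 * (k ^ 2 * s ^ 2)))

lemma gaussPdf_le_bd (d : ℕ) (s k z : ℝ) (hs : 0 < s) (hz : z ∈ Set.Ioc (1 : ℝ) k)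
    (m y : EuclideanSpace ℝ (Fin d)) :
    gaussPdf d m (z ^ 2 * s ^ 2) y ≤ bd d s k (y - m) := by
  obtain ⟨h1, h2⟩ := hz
  unfold gaussPdf bd
  have hz0 : 0 < z := by linarith
  have hzz : 1 ≤ z ^ 2 := by nlinarith
  have hzk : z ^ 2 ≤ k ^ 2 := by nlinarith
  have hk0 : 0 < k := by linarith
  apply mul_le_mul
  · apply Real.rpow_le_rpow_of_nonpos (by positivity)
    · have : s ^ 2 ≤ z ^ 2 * s ^ 2 := by nlinarith [sq_nonneg s]
      nlinarith [Real.pi_pos]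
    · have : (0 : ℝ) ≤ d := by positivity
      linarith
  · apply Real.exp_le_exp.2
    rw [neg_div, neg_div]
    apply neg_le_neg
    gcongr
  · positivity
  · positivity

lemma meas_gaussPdf3 (d : ℕ) (s : ℝ) (f : EuclideanSpace ℝ (Fin d) → EuclideanSpace ℝ (Fin d))
    (hf : Measurable f) :
    Measurable (fun w : (EuclideanSpace ℝ (Fin d) × EuclideanSpace ℝ (Fin d)) × ℝ =>
      gaussPdf d (f w.1.1) (w.2 ^ 2 * s ^ 2) w.1.2) := by
  unfold gaussPdf
  have h1 : Measurable (fun w : (EuclideanSpace ℝ (Fin d) × EuclideanSpace ℝ (Fin d)) × ℝ =>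
      ‖w.1.2 - f w.1.1‖) := by fun_prop
  fun_prop

lemma meas_gaussPdf (d : ℕ) (m : EuclideanSpace ℝ (Fin d)) (v : ℝ) :
    Measurable (gaussPdf d m v) := by
  unfold gaussPdf
  fun_prop

lemma rpow_bound (K β p q : ℝ) (hK : 0 ≤ K) (hβ : 0 ≤ β) (hβ1 : β ≤ 1) (hp : 0 ≤ p)
    (hq : 0 < q) : |K * (1 - (p / q) ^ β) * q| ≤ K * (p + 2 * q) := by
  have ht : 0 ≤ p / q := by positivity
  have h1 : (p / q) ^ β ≤ 1 + p / q := by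
    rcases le_total (p / q) 1 with h | h
    · have := Real.rpow_le_one ht h hβ
      linarith
    · have := Real.rpow_le_rpow_of_exponent_le h hβ1
      rw [Real.rpow_one] at this
      linarith
  have h0 : 0 ≤ (p / q) ^ β := by positivity
  rw [abs_mul, abs_mul, abs_of_nonneg hK, abs_of_pos hq, mul_assoc]
  apply mul_le_mul_of_nonneg_left _ hK
  have h2 : |1 - (p / q) ^ β| ≤ 2 + p / q := by
    rw [abs_le]; constructor <;> linarith
  calc _ ≤ (2 + p / q) * q := mul_le_mul_of_nonneg_right h2 hq.le
    _ = p + 2 * q := by field_simp; ring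

/-- The integrand of the risk. -/
noncomputable def Gf (d : ℕ) (α σX σY : ℝ) (θ : EuclideanSpace ℝ (Fin d))
    (w : EuclideanSpace ℝ (Fin d) × EuclideanSpace ℝ (Fin d)) (p : ℝ) : ℝ :=
  gaussPdf d θ (σX ^ 2) w.1 * ((4 / (1 - α ^ 2)) *
    (1 - (p / gaussPdf d θ (σY ^ 2) w.2) ^ ((1 + α) / 2)) * gaussPdf d θ (σY ^ 2) w.2)

/-- The dominating function. -/
noncomputable def Df (d : ℕ) (α σX σY k : ℝ)
    (f : EuclideanSpace ℝ (Fin d) → EuclideanSpace ℝ (Fin d)) (θ : EuclideanSpace ℝ (Fin d))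
    (w : EuclideanSpace ℝ (Fin d) × EuclideanSpace ℝ (Fin d)) : ℝ :=
  gaussPdf d θ (σX ^ 2) w.1 * ((4 / (1 - α ^ 2)) *
    (bd d σY k (w.2 - f w.1) + 2 * gaussPdf d θ (σY ^ 2) w.2))

lemma Gf_bound (d : ℕ) (α : ℝ) (hα : α ∈ Set.Ioo (-1 : ℝ) 1) (σX σY k : ℝ) (hσX : 0 < σX)
    (hσY : 0 < σY)
    (f : EuclideanSpace ℝ (Fin d) → EuclideanSpace ℝ (Fin d)) (θ : EuclideanSpace ℝ (Fin d))
    (w : EuclideanSpace ℝ (Fin d) × EuclideanSpace ℝ (Fin d)) (p : ℝ) (hp : 0 ≤ p)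
    (hpb : p ≤ bd d σY k (w.2 - f w.1)) :
    ‖Gf d α σX σY θ w p‖ ≤ Df d α σX σY k f θ w := by
  obtain ⟨h1, h2⟩ := hα
  have hK : 0 ≤ 4 / (1 - α ^ 2) := div_nonneg (by norm_num) (by nlinarith)
  have hg := gaussPdf_pos d θ (σX ^ 2) (by positivity) w.1
  have hq := gaussPdf_pos d θ (σY ^ 2) (by positivity) w.2
  unfold Gf Df
  rw [Real.norm_eq_abs, abs_mul, abs_of_pos hg]
  apply mul_le_mul_of_nonneg_left _ hg.le
  refine (rpow_bound _ _ _ _ hK (by linarith) (by linarith) hp hq).trans ?_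
  apply mul_le_mul_of_nonneg_left _ hK
  linarith

lemma integrable_bd (d : ℕ) (s k : ℝ) (hs : 0 < s) (hk : 0 < k) : Integrable (bd d s k) := by
  unfold bd
  exact (integrable_exp_norm d _ (by positivity)).const_mul _

lemma integrable_Df (d : ℕ) (α : ℝ) (σX σY k : ℝ) (hσX : 0 < σX)
    (hσY : 0 < σY) (hk : 0 < k)
    (f : EuclideanSpace ℝ (Fin d) → EuclideanSpace ℝ (Fin d)) (hf : Measurable f)
    (θ : EuclideanSpace ℝ (Fin d)) :
    Integrable (Df d α σX σY k f θ) (volume.prod volume) := by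
  have hg := integrable_gaussPdf d θ (σX ^ 2) (by positivity)
  have hq := integrable_gaussPdf d θ (σY ^ 2) (by positivity)
  have hb := integrable_bd d σY k hσY hk
  have hbm : Measurable (bd d σY k) := by unfold bd; fun_prop
  have hgm := meas_gaussPdf d θ (σX ^ 2)
  have A : Integrable (fun w : EuclideanSpace ℝ (Fin d) × EuclideanSpace ℝ (Fin d) =>
      gaussPdf d θ (σX ^ 2) w.1 * bd d σY k (w.2 - f w.1)) (volume.prod volume) := by
    have hm : Measurable (fun w : EuclideanSpace ℝ (Fin d) × EuclideanSpace ℝ (Fin d) =>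
      gaussPdf d θ (σX ^ 2) w.1 * bd d σY k (w.2 - f w.1)) := by fun_prop
    rw [integrable_prod_iff hm.aestronglyMeasurable]
    constructor
    · exact Filter.Eventually.of_forall fun x =>
        (hb.comp_sub_right (f x)).const_mul (gaussPdf d θ (σX ^ 2) x)
    · have : (fun x => ∫ y, ‖gaussPdf d θ (σX ^ 2) x * bd d σY k (y - f x)‖) =
          fun x => ‖gaussPdf d θ (σX ^ 2) x‖ * ∫ y, ‖bd d σY k y‖ := by
        ext x
        simp only [norm_mul]
        rw [integral_const_mul, integral_sub_right_eq_self (fun y => ‖bd d σY k y‖)]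
      simp only [this]
      exact hg.norm.mul_const _
  have B := hg.mul_prod hq
  have := (A.const_mul (4 / (1 - α ^ 2))).add (B.const_mul (4 / (1 - α ^ 2) * 2))
  refine this.congr (Filter.Eventually.of_forall fun w => ?_)
  simp only [Df, Pi.add_apply]
  ring

lemma meas_Gf (d : ℕ) (α σX σY : ℝ) (θ : EuclideanSpace ℝ (Fin d)) {T : Type*}
    [MeasurableSpace T] (u : T → EuclideanSpace ℝ (Fin d) × EuclideanSpace ℝ (Fin d))
    (hu : Measurable u) (p : T → ℝ) (hp : Measurable p) :
    Measurable (fun t => Gf d α σX σY θ (u t) (p t)) := by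
  unfold Gf
  have h1 := meas_gaussPdf d θ (σX ^ 2)
  have h2 := meas_gaussPdf d θ (σY ^ 2)
  fun_prop

lemma integrable_Gf (d : ℕ) (α : ℝ) (hα : α ∈ Set.Ioo (-1 : ℝ) 1) (σX σY k : ℝ) (hσX : 0 < σX)
    (hσY : 0 < σY) (hk : 0 < k)
    (f : EuclideanSpace ℝ (Fin d) → EuclideanSpace ℝ (Fin d)) (hf : Measurable f)
    (θ : EuclideanSpace ℝ (Fin d))
    (p : EuclideanSpace ℝ (Fin d) → EuclideanSpace ℝ (Fin d) → ℝ)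
    (hpm : Measurable (fun w : EuclideanSpace ℝ (Fin d) × EuclideanSpace ℝ (Fin d) => p w.1 w.2))
    (hp : ∀ x y, 0 ≤ p x y) (hpb : ∀ x y, p x y ≤ bd d σY k (y - f x)) :
    Integrable (fun w : EuclideanSpace ℝ (Fin d) × EuclideanSpace ℝ (Fin d) =>
      Gf d α σX σY θ w (p w.1 w.2)) (volume.prod volume) := by
  refine (integrable_Df d α σX σY k hσX hσY hk f hf θ).mono'
    (meas_Gf d α σX σY θ _ measurable_id _ hpm).aestronglyMeasurable ?_
  exact Filter.Eventually.of_forall fun w =>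
    Gf_bound d α hα σX σY k hσX hσY f θ w _ (hp _ _) (hpb _ _)

lemma risk_eq (d : ℕ) (α : ℝ) (hα : α ∈ Set.Ioo (-1 : ℝ) 1) (σX σY k : ℝ) (hσX : 0 < σX)
    (hσY : 0 < σY) (hk : 0 < k)
    (f : EuclideanSpace ℝ (Fin d) → EuclideanSpace ℝ (Fin d)) (hf : Measurable f)
    (θ : EuclideanSpace ℝ (Fin d))
    (p : EuclideanSpace ℝ (Fin d) → EuclideanSpace ℝ (Fin d) → ℝ)
    (hpm : Measurable (fun w : EuclideanSpace ℝ (Fin d) × EuclideanSpace ℝ (Fin d) => p w.1 w.2))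
    (hp : ∀ x y, 0 ≤ p x y) (hpb : ∀ x y, p x y ≤ bd d σY k (y - f x)) :
    alphaRiskGen d α σX σY p θ =
      ∫ w : EuclideanSpace ℝ (Fin d) × EuclideanSpace ℝ (Fin d),
        Gf d α σX σY θ w (p w.1 w.2) ∂(volume.prod volume) := by
  rw [integral_prod _ (integrable_Gf d α hα σX σY k hσX hσY hk f hf θ p hpm hp hpb)]
  unfold alphaRiskGen alphaLoss Gf
  simp only [integral_const_mul]

lemma jensen_Gf (d : ℕ) (α : ℝ) (hα : α ∈ Set.Ioo (-1 : ℝ) 1) (σX σY : ℝ) (hσX : 0 < σX)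
    (hσY : 0 < σY) (θ : EuclideanSpace ℝ (Fin d))
    (w : EuclideanSpace ℝ (Fin d) × EuclideanSpace ℝ (Fin d))
    (μ : Measure ℝ) [IsProbabilityMeasure μ] (p : ℝ → ℝ) (hpm : Measurable p) (hp : ∀ᵐ z ∂μ, 0 ≤ p z)
    (M : ℝ) (hM : ∀ᵐ z ∂μ, p z ≤ M) :
    Integrable p μ ∧ Gf d α σX σY θ w (∫ z, p z ∂μ) ≤ ∫ z, Gf d α σX σY θ w (p z) ∂μ := by
  obtain ⟨h1, h2⟩ := hα
  have hK : 0 ≤ 4 / (1 - α ^ 2) := div_nonneg (by norm_num) (by nlinarith)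
  have hg := gaussPdf_pos d θ (σX ^ 2) (by positivity) w.1
  have hq := gaussPdf_pos d θ (σY ^ 2) (by positivity) w.2
  have hβ : 0 ≤ (1 + α) / 2 := by linarith
  have hβ1 : (1 + α) / 2 ≤ 1 := by linarith
  unfold Gf
  generalize gaussPdf d θ (σX ^ 2) w.1 = g at *
  generalize gaussPdf d θ (σY ^ 2) w.2 = q at *
  generalize (1 + α) / 2 = β at *
  generalize 4 / (1 - α ^ 2) = K at *
  have hpi : Integrable p μ := by
    refine Integrable.mono' (integrable_const M) hpm.aestronglyMeasurable ?_
    filter_upwards [hp, hM] with z hz hz'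
    rwa [Real.norm_eq_abs, abs_of_nonneg hz]
  have hri : Integrable (fun z => (p z / q) ^ β) μ := by
    refine Integrable.mono' (integrable_const ((M / q) ^ β))
      (by fun_prop : Measurable fun z => (p z / q) ^ β).aestronglyMeasurable ?_
    filter_upwards [hp, hM] with z hz hz'
    have : 0 ≤ p z / q := by positivity
    rw [Real.norm_eq_abs, abs_of_nonneg (by positivity)]
    gcongr
  refine ⟨hpi, ?_⟩
  have J : ∫ z, (p z / q) ^ β ∂μ ≤ (∫ z, p z / q ∂μ) ^ β := by
    refine (Real.concaveOn_rpow hβ hβ1).le_map_integral (f := fun z => p z / q)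
      (Real.continuous_rpow_const hβ).continuousOn isClosed_Ici ?_ (hpi.div_const q) hri
    filter_upwards [hp] with z hz
    exact div_nonneg hz hq.le
  rw [integral_div] at J
  rw [integral_const_mul, integral_mul_const, integral_const_mul,
    integral_sub (integrable_const _) hri]
  simp only [integral_const, probReal_univ, one_smul]
  gcongr

lemma mix_le (d : ℕ) (α : ℝ) (hα : α ∈ Set.Ioo (-1 : ℝ) 1) (σX σY k : ℝ) (hσX : 0 < σX)
    (hσY : 0 < σY) (hk : 1 < k)
    (f : EuclideanSpace ℝ (Fin d) → EuclideanSpace ℝ (Fin d)) (hf : Measurable f)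
    (θ : EuclideanSpace ℝ (Fin d))
    (μ : Measure ℝ) [IsProbabilityMeasure μ] (hμ : ∀ᵐ z ∂μ, z ∈ Set.Ioc 1 k) :
    Integrable (fun z => alphaRisk d α σX σY f z θ) μ ∧
    alphaRiskGen d α σX σY (fun x y => ∫ z, gaussPdf d (f x) (z ^ 2 * σY ^ 2) y ∂μ) θ ≤
      ∫ z, alphaRisk d α σX σY f z θ ∂μ := by
  have hk0 : 0 < k := by linarith
  have hm3 := meas_gaussPdf3 d σY f hf
  have hDi := integrable_Df d α σX σY k hσX hσY hk0 f hf θ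
  have hpos : ∀ z ∈ Set.Ioc 1 k, ∀ x y, 0 ≤ gaussPdf d (f x) (z ^ 2 * σY ^ 2) y := by
    intro z hz x y
    have : 0 < z := by linarith [hz.1]
    exact (gaussPdf_pos d _ _ (by positivity) y).le
  have hle : ∀ z ∈ Set.Ioc 1 k, ∀ x y,
      gaussPdf d (f x) (z ^ 2 * σY ^ 2) y ≤ bd d σY k (y - f x) :=
    fun z hz x y => gaussPdf_le_bd d σY k z hσY hz _ _
  have hJ := fun w : EuclideanSpace ℝ (Fin d) × EuclideanSpace ℝ (Fin d) =>
    jensen_Gf d α hα σX σY hσX hσY θ w μ (fun z => gaussPdf d (f w.1) (z ^ 2 * σY ^ 2) w.2)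
      (hm3.comp (measurable_const.prodMk measurable_id : Measurable fun z : ℝ => (w, z)))
      (hμ.mono fun z hz => hpos z hz _ _) _ (hμ.mono fun z hz => hle z hz _ _)
  have hint : Integrable (fun t : (EuclideanSpace ℝ (Fin d) × EuclideanSpace ℝ (Fin d)) × ℝ =>
      Gf d α σX σY θ t.1 (gaussPdf d (f t.1.1) (t.2 ^ 2 * σY ^ 2) t.1.2))
      ((volume.prod volume).prod μ) := by
    refine (hDi.comp_fst μ).mono'
      (meas_Gf d α σX σY θ _ measurable_fst _ hm3).aestronglyMeasurable ?_
    filter_upwards [Measure.quasiMeasurePreserving_snd.ae hμ] with t ht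
    exact Gf_bound d α hα σX σY k hσX hσY f θ _ _ (hpos _ ht _ _) (hle _ ht _ _)
  have hR : (fun z => ∫ w : EuclideanSpace ℝ (Fin d) × EuclideanSpace ℝ (Fin d),
      Gf d α σX σY θ w (gaussPdf d (f w.1) (z ^ 2 * σY ^ 2) w.2) ∂(volume.prod volume)) =ᵐ[μ]
      fun z => alphaRisk d α σX σY f z θ := by
    filter_upwards [hμ] with z hz
    exact (risk_eq d α hα σX σY k hσX hσY hk0 f hf θ
      (fun x => gaussPdf d (f x) (z ^ 2 * σY ^ 2))
      (hm3.comp (measurable_id.prodMk measurable_const)) (hpos z hz) (hle z hz)).symm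
  refine ⟨hint.integral_prod_right.congr hR, ?_⟩
  have hbm : Measurable (fun w : EuclideanSpace ℝ (Fin d) × EuclideanSpace ℝ (Fin d) =>
      ∫ z, gaussPdf d (f w.1) (z ^ 2 * σY ^ 2) w.2 ∂μ) :=
    (hm3.stronglyMeasurable.integral_prod_right').measurable
  have hb0 : ∀ x y, 0 ≤ ∫ z, gaussPdf d (f x) (z ^ 2 * σY ^ 2) y ∂μ := fun x y =>
    integral_nonneg_of_ae (hμ.mono fun z hz => hpos z hz x y)
  have hb1 : ∀ x y, ∫ z, gaussPdf d (f x) (z ^ 2 * σY ^ 2) y ∂μ ≤ bd d σY k (y - f x) := by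
    intro x y
    have := integral_mono_ae (hJ (x, y)).1 (integrable_const (bd d σY k (y - f x)))
      (hμ.mono fun z hz => hle z hz x y)
    simpa using this
  rw [← integral_congr_ae hR, ← integral_integral_swap hint,
    risk_eq d α hα σX σY k hσX hσY hk0 f hf θ _ hbm hb0 hb1]
  have hI1 := integrable_Gf d α hα σX σY k hσX hσY hk0 f hf θ
    (fun x y => ∫ z, gaussPdf d (f x) (z ^ 2 * σY ^ 2) y ∂μ) hbm hb0 hb1
  have hI2 := hint.integral_prod_left
  refine integral_mono hI1 hI2 ?_
  intro w
  have := (hJ w).2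
  exact this

theorem stmt15 (d : ℕ) (hd : 1 ≤ d) (α : ℝ) (hα : α ∈ Set.Ioo (-1 : ℝ) 1)
    (σX σY : ℝ) (hσX : 0 < σX) (hσY : 0 < σY)
    (C : Set (EuclideanSpace ℝ (Fin d))) (hC : C.Nonempty)
    (θhat : EuclideanSpace ℝ (Fin d) → EuclideanSpace ℝ (Fin d)) (hmeas : Measurable θhat)
    (kstar : ℝ) (hkstar : 1 < kstar)
    (hdom : ∀ z ∈ Set.Ioc (1 : ℝ) kstar, ∀ θ ∈ C,
      alphaRisk d α σX σY θhat z θ ≤ alphaRisk d α σX σY θhat 1 θ)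
    (θ₀ : EuclideanSpace ℝ (Fin d)) (hθ₀ : θ₀ ∈ C)
    (hstrict : ∀ z ∈ Set.Ioc (1 : ℝ) kstar,
      alphaRisk d α σX σY θhat z θ₀ < alphaRisk d α σX σY θhat 1 θ₀)
    (μ : Measure ℝ) [IsProbabilityMeasure μ] (hμ : μ (Set.Ioc 1 kstar) = 1) :
    (∀ θ ∈ C,
      alphaRiskGen d α σX σY
          (fun x y => ∫ z, gaussPdf d (θhat x) (z ^ 2 * σY ^ 2) y ∂μ) θ ≤
        alphaRisk d α σX σY θhat 1 θ) ∧
    alphaRiskGen d α σX σY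
        (fun x y => ∫ z, gaussPdf d (θhat x) (z ^ 2 * σY ^ 2) y ∂μ) θ₀ <
      alphaRisk d α σX σY θhat 1 θ₀ := by
  have hae : ∀ᵐ z ∂μ, z ∈ Set.Ioc 1 kstar := by
    rw [← prob_compl_eq_zero_iff measurableSet_Ioc] at hμ
    exact measure_eq_zero_iff_ae_notMem.1 hμ |>.mono fun z hz => by simpa using hz
  have key := fun θ => mix_le d α hα σX σY kstar hσX hσY hkstar θhat hmeas θ μ hae
  constructor
  · intro θ hθ
    refine (key θ).2.trans ?_
    have := integral_mono_ae (key θ).1 (integrable_const (alphaRisk d α σX σY θhat 1 θ))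
      (hae.mono fun z hz => hdom z hz θ hθ)
    simpa using this
  · refine (key θ₀).2.trans_lt ?_
    have hi := (integrable_const (μ := μ) (alphaRisk d α σX σY θhat 1 θ₀)).sub (key θ₀).1
    have hpos : 0 < ∫ z, (alphaRisk d α σX σY θhat 1 θ₀ - alphaRisk d α σX σY θhat z θ₀) ∂μ := by
      rw [integral_pos_iff_support_of_nonneg_ae
        (hae.mono fun z hz => sub_nonneg.2 (hstrict z hz).le) hi]
      refine lt_of_lt_of_le (by rw [hμ]; exact one_pos)
        (measure_mono (s := Set.Ioc 1 kstar) fun z hz => ?_)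
      exact (sub_pos.2 (hstrict z hz)).ne'
    rw [integral_sub (integrable_const _) (key θ₀).1] at hpos
    simpa using hpos
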